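/- For any subset S ⊆ [n−1] and any subset P ⊆ [n], the statistics inv and imaj are equidistributed on the set of permutations π ∈ S_n with Des(π) ⊆ S and PLrmax(π) = P; that is, Σ_π q^{inv(π)} = Σ_π q^{imaj(π)} where both sums are over {π ∈ S_n : Des(π) ⊆ S, PLrmax(π) = P}. -/

import Mathlib

open Polynomial

/-- The number of inversions of a word. -/
def inv {n : ℕ} {β : Type*} [LinearOrder β] (w : Fin n → β) : ℕ :=
  (Finset.univ.filter (fun p : Fin n × Fin n => p.1 < p.2 ∧ w p.2 < w p.1)).card

/-- The major index of a word (sum of 1-based descent positions). -/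
def maj {n : ℕ} {β : Type*} [LinearOrder β] (w : Fin n → β) : ℕ :=
  ∑ p ∈ Finset.univ.filter
      (fun p : Fin n × Fin n => (p.2 : ℕ) = (p.1 : ℕ) + 1 ∧ w p.2 < w p.1),
    ((p.1 : ℕ) + 1)

/-- The set of positions of left-to-right maxima of a permutation. -/
def PLrmax {n : ℕ} (π : Equiv.Perm (Fin n)) : Finset (Fin n) :=
  Finset.univ.filter (fun i : Fin n => ∀ j, j < i → π j < π i)

/-- `Des(π) ⊆ S` where `S = {s 1, …, s k}` (1-based positions). -/
def DesSubset (n k : ℕ) (s : ℕ → ℕ) (π : Equiv.Perm (Fin n)) : Prop :=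
  ∀ p : Fin n × Fin n, (p.2 : ℕ) = (p.1 : ℕ) + 1 → π p.2 < π p.1 →
    ∃ j ∈ Finset.Icc 1 k, (p.1 : ℕ) + 1 = s j

instance (n k : ℕ) (s : ℕ → ℕ) : DecidablePred (DesSubset n k s) := fun _ => by
  unfold DesSubset; infer_instance

namespace FoataAux

variable {α : Type*} [LinearOrder α]

/-- Rotate the blocks (each starting with a `p`-letter) of the reversed word `y :: t`. -/
def rotB (p : α → Bool) : α → List α → List α
  | y, [] => [y]
  | y, x :: t => if p x then y :: rotB p x t else x :: rotB p y t

/-- One step of the Foata map, on reversed words. -/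
def stepR (a : α) : List α → List α
  | [] => []
  | y :: t => rotB (fun x => decide (x < a ↔ y < a)) y t

/-- The Foata map on reversed words. -/
def foata : List α → List α
  | [] => []
  | a :: w => a :: stepR a (foata w)

/-- Inversions of a reversed word. -/
def invL : List α → ℕ
  | [] => 0
  | a :: w => invL w + w.countP (fun y => decide (a < y))

/-- Major index of a reversed word. -/
def majL : List α → ℕ
  | [] => 0
  | [_] => 0
  | a :: y :: t => majL (y :: t) + if a < y then t.length + 1 else 0

lemma rotB_perm (p : α → Bool) (t : List α) : ∀ y, (rotB p y t).Perm (y :: t) := by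
  induction t with
  | nil => intro y; simp [rotB]
  | cons x t ih =>
    intro y
    unfold rotB
    split_ifs
    · exact (ih x).cons y
    · exact ((ih y).cons x).trans (List.Perm.swap _ _ _)

lemma stepR_perm (a : α) (v : List α) : (stepR a v).Perm v := by
  cases v with
  | nil => simp [stepR]
  | cons y t => exact rotB_perm _ _ _

lemma foata_perm (l : List α) : (foata l).Perm l := by
  induction l with
  | nil => simp [foata]
  | cons a w ih => exact ((stepR_perm a _).trans ih).cons a

lemma rotB_inj (p : α → Bool) (t : List α) : ∀ y t' y', p y → p y' →
    rotB p y t = rotB p y' t' → y = y' ∧ t = t' := by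
  induction t with
  | nil =>
    intro y t' y' hy hy' h
    have hl := congrArg List.length h
    rw [(rotB_perm p _ _).length_eq, (rotB_perm p _ _).length_eq] at hl
    cases t' with
    | nil => simpa [rotB] using h
    | cons _ _ => simp at hl
  | cons x u ih =>
    intro y t' y' hy hy' h
    cases t' with
    | nil =>
      have hl := congrArg List.length h
      rw [(rotB_perm p _ _).length_eq, (rotB_perm p _ _).length_eq] at hl
      simp at hl
    | cons x' u' =>
      unfold rotB at h
      split_ifs at h <;> grind

lemma rotB_last (p : α → Bool) (t : List α) : ∀ y, p y → ∀ z ∈ (rotB p y t).getLast?, p z := by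
  induction t with
  | nil => intro y hy; simp [rotB, hy]
  | cons x t ih =>
    intro y hy z hz
    unfold rotB at hz
    have hne : ∀ y, rotB p y t ≠ [] := fun y h => by
      have := (rotB_perm p t y).length_eq
      simp [h] at this
    split_ifs at hz with hx
    · rw [List.getLast?_cons_of_ne_nil (hne x)] at hz
      exact ih x hx z hz
    · rw [List.getLast?_cons_of_ne_nil (hne y)] at hz
      exact ih y hy z hz

lemma stepR_inj (a : α) (v v' : List α) (h : stepR a v = stepR a v') : v = v' := by
  have hl : v.length = v'.length := by
    rw [← (stepR_perm a v).length_eq, h, (stepR_perm a v').length_eq]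
  cases v with
  | nil => cases v' with
    | nil => rfl
    | cons _ _ => simp at hl
  | cons y t => cases v' with
    | nil => simp at hl
    | cons y' t' =>
      simp only [stepR] at h
      have hc : (y < a ↔ y' < a) := by
        have h1 := rotB_last (fun x => decide (x < a ↔ y < a)) t y (by simp)
        have h2 := rotB_last (fun x => decide (x < a ↔ y' < a)) t' y' (by simp)
        rw [h] at h1
        obtain ⟨z, hz⟩ : ∃ z, (rotB (fun x => decide (x < a ↔ y' < a)) y' t').getLast? = some z := by
          rw [← Option.ne_none_iff_exists']
          intro h0
          rw [List.getLast?_eq_none_iff] at h0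
          have := (rotB_perm (fun x => decide (x < a ↔ y' < a)) t' y').length_eq
          rw [h0] at this
          simp at this
        have h1 := h1 z hz
        have h2 := h2 z hz
        simp only [decide_eq_true_eq] at h1 h2
        tauto
      have hp : (fun x => decide (x < a ↔ y < a)) = (fun x => decide (x < a ↔ y' < a)) := by
        funext x; simp [hc]
      rw [hp] at h
      obtain ⟨h1, h2⟩ := rotB_inj _ _ _ _ _ (by simp [hc]) (by simp) h
      rw [h1, h2]

lemma foata_inj : Function.Injective (foata : List α → List α) := by
  intro l
  induction l with
  | nil =>
    intro l' h
    cases l' with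
    | nil => rfl
    | cons _ _ => simp [foata] at h
  | cons a w ih =>
    intro l' h
    cases l' with
    | nil => simp [foata] at h
    | cons b w' =>
      simp only [foata, List.cons.injEq] at h
      obtain ⟨rfl, h⟩ := h
      rw [ih (stepR_inj _ _ _ h)]

lemma rotB_inv_gt (p : α → Bool) (t : List α) : ∀ y, p y →
    (∀ x ∈ y :: t, ∀ z ∈ y :: t, p x → ¬ p z → z < x) →
    invL (rotB p y t) = invL (y :: t) + t.countP (fun z => !p z) := by
  induction t with
  | nil => intro y _ _; simp [rotB]
  | cons x t ih =>
    intro y hy h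
    unfold rotB
    split_ifs with hx
    · have := ih x hx (by grind)
      simp only [invL] at this ⊢
      rw [this, (rotB_perm p t x).countP_eq]
      simp [hx, List.countP_cons]
      omega
    · have := ih y hy (by grind)
      have hxy : x < y := h y (by simp) x (by simp) hy hx
      simp only [invL] at this ⊢
      rw [this, (rotB_perm p t y).countP_eq]
      simp [hx, List.countP_cons, hxy, hxy.le]
      omega

lemma rotB_inv_lt (p : α → Bool) (t : List α) : ∀ y, p y →
    (∀ x ∈ y :: t, ∀ z ∈ y :: t, p x → ¬ p z → x < z) →
    invL (rotB p y t) + t.countP (fun z => !p z) = invL (y :: t) := by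
  induction t with
  | nil => intro y _ _; simp [rotB]
  | cons x t ih =>
    intro y hy h
    unfold rotB
    split_ifs with hx
    · have := ih x hx (by grind)
      simp only [invL] at this ⊢
      rw [← this, (rotB_perm p t x).countP_eq]
      simp [hx, List.countP_cons]
      omega
    · have := ih y hy (by grind)
      have hxy : y < x := h y (by simp) x (by simp) hy hx
      simp only [invL] at this ⊢
      rw [(rotB_perm p t y).countP_eq]
      simp [hx, List.countP_cons, hxy, hxy.le]
      omega

lemma stepR_inv (a y : α) (t : List α) (ha : a ∉ y :: t) :
    invL (a :: stepR a (y :: t)) = invL (y :: t) + if a < y then t.length + 1 else 0 := by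
  have hne : ∀ z ∈ y :: t, z ≠ a := fun z hz h => ha (h ▸ hz)
  rw [invL, (stepR_perm a _).countP_eq]
  simp only [stepR]
  split_ifs with hy
  · rw [rotB_inv_gt _ _ _ (by simp) (by
      intro x hx z hz h1 h2
      simp [not_lt.2 hy.le] at h1 h2
      exact h2.trans_le h1)]
    have := List.length_eq_countP_add_countP (fun z => decide (a < z)) (l := t)
    have h2 : t.countP (fun z => !decide (z < a ↔ y < a)) =
        t.countP (fun z => decide ¬ (decide (a < z) = true)) := by
      apply List.countP_congr
      intro z hz
      have := hne z (by simp [hz])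
      simp [not_lt.2 hy.le]
      exact ⟨fun h => h.le, fun h => lt_of_le_of_ne h this⟩
    rw [h2, List.countP_cons]
    simp only [hy] at *
    simp at *
    omega
  · have hy' : y < a := lt_of_le_of_ne (not_lt.1 hy) (hne y (by simp))
    rw [← rotB_inv_lt (fun x => decide (x < a ↔ y < a)) t y (by simp) (by
      intro x hx z hz h1 h2
      simp [hy'] at h1 h2
      exact h1.trans_le h2)]
    have h2 : t.countP (fun z => !decide (z < a ↔ y < a)) =
        t.countP (fun z => decide (a < z)) := by
      apply List.countP_congr
      intro z hz
      have := hne z (by simp [hz])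
      simp [hy']
      exact ⟨fun h => lt_of_le_of_ne h this.symm, fun h => h.le⟩
    rw [h2, List.countP_cons]
    simp [hy]

lemma foata_head (a : α) (w : List α) : ∃ t, foata (a :: w) = a :: t ∧ t.length = w.length := by
  refine ⟨_, rfl, ?_⟩
  rw [(stepR_perm a _).length_eq, (foata_perm w).length_eq]

lemma foata_inv (l : List α) (hl : l.Nodup) : invL (foata l) = majL l := by
  induction l with
  | nil => simp [foata, invL, majL]
  | cons a w ih =>
    cases w with
    | nil => simp [foata, stepR, invL, majL]
    | cons y t =>
      have hm : a ∉ foata (y :: t) := by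
        rw [(foata_perm (y :: t)).mem_iff]
        exact (List.nodup_cons.1 hl).1
      have ih := ih (List.nodup_cons.1 hl).2
      obtain ⟨u, hu, hlen⟩ := foata_head y t
      rw [hu] at hm ih
      rw [foata, hu, stepR_inv a y u hm, ih, majL, hlen]

lemma rotB_find (p q : α → Bool) (t : List α) : ∀ y, p y →
    ((∀ x ∈ y :: t, q x → p x) ∨ (∀ x ∈ y :: t, q x → ¬ p x)) →
    (rotB p y t).find? q = (y :: t).find? q := by
  induction t with
  | nil => intro y _ _; simp [rotB]
  | cons x t ih =>
    intro y hy h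
    unfold rotB
    split_ifs with hx
    · have := ih x hx (by grind)
      rw [List.find?_cons, List.find?_cons, this]
    · have := ih y hy (by grind)
      rw [List.find?_cons, this]
      grind

lemma foata_find (l : List α) (hl : l.Nodup) (b c : α) :
    (foata l).find? (fun z => decide (b ≤ z ∧ z ≤ c)) =
      l.find? (fun z => decide (b ≤ z ∧ z ≤ c)) := by
  induction l with
  | nil => simp [foata]
  | cons a w ih =>
    have ih := ih (List.nodup_cons.1 hl).2
    rw [foata, List.find?_cons, List.find?_cons, ← ih]
    by_cases ha : b ≤ a ∧ a ≤ c
    · simp [ha]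
    · simp only [ha, decide_false]
      have hm : a ∉ foata w := by
        rw [(foata_perm w).mem_iff]
        exact (List.nodup_cons.1 hl).1
      cases hv : foata w with
      | nil => simp [stepR]
      | cons y t =>
        simp only [stepR]
        apply rotB_find
        · simp
        · have key : (∀ x, b ≤ x ∧ x ≤ c → x < a) ∨ (∀ x, b ≤ x ∧ x ≤ c → ¬ x < a) := by
            by_cases h1 : b ≤ a
            · left
              intro x hx
              exact hx.2.trans_lt (not_le.1 fun h => ha ⟨h1, h⟩)
            · right
              intro x hx
              exact not_lt.2 ((not_le.1 h1).le.trans hx.1)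
          by_cases hy : y < a
          · simp only [hy, iff_true]
            rcases key with h | h
            · left; intro x _ hx; simpa using h x (by simpa using hx)
            · right; intro x _ hx; simpa using h x (by simpa using hx)
          · simp only [hy, iff_false]
            rcases key with h | h
            · right; intro x _ hx; simpa using h x (by simpa using hx)
            · left; intro x _ hx; simpa using h x (by simpa using hx)

/-- reversed word of a function -/
def revw {n : ℕ} {β : Type*} (w : Fin n → β) : List β := List.ofFn (fun i => w i.rev)

lemma revw_succ {n : ℕ} {β : Type*} (w : Fin (n + 1) → β) :
    revw w = w (Fin.last n) :: revw (fun i => w i.castSucc) := by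
  simp [revw, List.ofFn_succ, Fin.rev_succ]

lemma countP_revw {β : Type*} (q : β → Bool) : ∀ {n : ℕ} (w : Fin n → β),
    (revw w).countP q = ∑ i, if q (w i) then 1 else 0 := by
  intro n
  induction n with
  | zero => intro w; simp [revw]
  | succ n ih => intro w; rw [revw_succ, List.countP_cons, ih, Fin.sum_univ_castSucc]

lemma inv_eq (n : ℕ) (w : Fin n → α) : inv w = invL (revw w) := by
  induction n with
  | zero => simp [inv, revw, invL]
  | succ n ih =>
    rw [revw_succ, invL, ← ih, countP_revw]
    simp only [inv, Finset.card_filter, Fintype.sum_prod_type]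
    rw [Fin.sum_univ_castSucc]
    simp only [Fin.sum_univ_castSucc, Fin.castSucc_lt_castSucc_iff, Fin.castSucc_lt_last]
    simp [Finset.sum_add_distrib, Fin.le_last, not_lt]

lemma maj_eq (n : ℕ) (w : Fin n → α) : maj w = majL (revw w) := by
  induction n with
  | zero => simp [maj, revw, majL]
  | succ n ih =>
    have h1 : maj w = maj (fun i : Fin n => w i.castSucc) +
        ∑ i : Fin n, if (n = (i : ℕ) + 1 ∧ w (Fin.last n) < w i.castSucc) then (i : ℕ) + 1 else 0 := by
      simp only [maj, Finset.sum_filter, Fintype.sum_prod_type]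
      rw [Fin.sum_univ_castSucc]
      simp only [Fin.sum_univ_castSucc]
      have h0 : ∀ i : Fin n, (i : ℕ) ≠ n + 1 := fun i => by omega
      simp [Finset.sum_add_distrib, h0]
    rw [h1, ih, revw_succ]
    cases n with
    | zero => simp [revw, majL]
    | succ n =>
      rw [revw_succ (fun i : Fin (n+1) => w i.castSucc), majL]
      congr 1
      rw [Fin.sum_univ_castSucc]
      have h0 : ∀ i : Fin n, n ≠ (i : ℕ) := fun i => by omega
      simp [h0, revw]

lemma find_revw {n : ℕ} (π : Equiv.Perm (Fin n)) (q : Fin n → Bool) (x : Fin n) :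
    (revw π.symm).find? q = some x ↔ q x ∧ ∀ y, q y → π y ≤ π x := by
  rw [List.find?_eq_some_iff_getElem]
  simp only [revw, List.getElem_ofFn, List.length_ofFn]
  refine and_congr_right fun _ => ⟨?_, ?_⟩
  · rintro ⟨i, hi, rfl, h⟩ y hy
    by_contra hlt
    have hlt := not_le.1 hlt
    rw [Equiv.apply_symm_apply, Fin.lt_def, Fin.val_rev] at hlt
    simp only at hlt
    have := h (π y).rev (by rw [Fin.val_rev]; omega)
    have he : (⟨((π y).rev : ℕ), (π y).rev.2⟩ : Fin n).rev = π y := by simp only [Fin.eta, Fin.rev_rev]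
    rw [he] at this
    simp [hy] at this
  · intro h
    refine ⟨(π x).rev, (π x).rev.2, by simp only [Fin.eta, Fin.rev_rev, Equiv.symm_apply_apply], ?_⟩
    intro j hj
    by_contra hq
    have hq : q (π.symm (Fin.rev ⟨j, by omega⟩)) = true := by simpa using hq
    have := h _ hq
    rw [Equiv.apply_symm_apply, Fin.le_def, Fin.val_rev] at this
    rw [Fin.val_rev] at hj
    simp only at this
    omega

lemma inv_symm {n : ℕ} (π : Equiv.Perm (Fin n)) : inv π.symm = inv π := by
  unfold inv
  refine Finset.card_bij' (fun p _ => (π.symm p.2, π.symm p.1)) (fun p _ => (π p.2, π p.1)) ?_ ?_ ?_ ?_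
  · intro p; simp; tauto
  · intro p; simp; tauto
  · intro p; simp
  · intro p; simp

lemma revw_nodup {n : ℕ} (π : Equiv.Perm (Fin n)) : (revw π).Nodup := by
  unfold revw
  rw [List.nodup_ofFn]
  exact π.injective.comp Fin.rev_injective

lemma exists_revw {n : ℕ} (l : List (Fin n)) (hl : l.Nodup) (hn : l.length = n) :
    ∃ π : Equiv.Perm (Fin n), revw π.symm = l := by
  have hinj : Function.Injective (fun i : Fin n => l.get ((i.rev).cast hn.symm)) := by
    intro i j h
    have := hl.injective_get h
    simpa using this
  refine ⟨(Equiv.ofBijective _ (Finite.injective_iff_bijective.1 hinj)).symm, ?_⟩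
  apply List.ext_get
  · simp [revw, hn]
  · intro i h1 h2
    simp [revw]
    congr 1
    omega

lemma exists_foata {n : ℕ} (π : Equiv.Perm (Fin n)) :
    ∃ π' : Equiv.Perm (Fin n), revw π'.symm = foata (revw π.symm) :=
  exists_revw _ ((foata_perm _).nodup_iff.2 (revw_nodup _))
    (by rw [(foata_perm _).length_eq]; simp [revw])

lemma revw_inj {n : ℕ} (π π' : Equiv.Perm (Fin n)) (h : revw π.symm = revw π'.symm) : π = π' := by
  have h := List.ofFn_injective h
  have : π.symm = π'.symm := by
    ext i
    have := congrFun h i.rev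
    simpa using congrArg Fin.val this
  simpa using congrArg Equiv.symm this

/-- order data of `π` on intervals is preserved -/
lemma max_iff {n : ℕ} (π π' : Equiv.Perm (Fin n)) (h : revw π'.symm = foata (revw π.symm))
    (b c x : Fin n) (hx : b ≤ x ∧ x ≤ c) :
    (∀ y, b ≤ y ∧ y ≤ c → π' y ≤ π' x) ↔ (∀ y, b ≤ y ∧ y ≤ c → π y ≤ π x) := by
  have h1 := find_revw π (fun z => decide (b ≤ z ∧ z ≤ c)) x
  have h2 := find_revw π' (fun z => decide (b ≤ z ∧ z ≤ c)) x
  rw [h, foata_find _ (revw_nodup _), h1] at h2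
  simpa [hx] using h2.symm

lemma des_iff {n : ℕ} (π : Equiv.Perm (Fin n)) (i j : Fin n) (hij : (j : ℕ) = i + 1) :
    π j < π i ↔ ∀ y, i ≤ y ∧ y ≤ j → π y ≤ π i := by
  constructor
  · intro h y hy
    have : y = i ∨ y = j := by
      rw [Fin.ext_iff, Fin.ext_iff]
      have := Fin.le_def.1 hy.1
      have := Fin.le_def.1 hy.2
      omega
    rcases this with rfl | rfl
    · exact le_rfl
    · exact h.le
  · intro h
    refine lt_of_le_of_ne (h j ⟨Fin.le_def.2 (by omega), le_rfl⟩) fun h => ?_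
    have := π.injective h
    subst this
    omega

lemma plr_iff {n : ℕ} (π : Equiv.Perm (Fin n)) (b i : Fin n) (hb : (b : ℕ) = 0) :
    (∀ j, j < i → π j < π i) ↔ ∀ y, b ≤ y ∧ y ≤ i → π y ≤ π i := by
  constructor
  · intro h y hy
    rcases hy.2.eq_or_lt with rfl | h1
    · exact le_rfl
    · exact (h y h1).le
  · intro h j hj
    refine lt_of_le_of_ne (h j ⟨Fin.le_def.2 (by omega), hj.le⟩) fun h => ?_
    exact hj.ne (π.injective h)

end FoataAux

open FoataAux

/-- for any `S ⊆ [n−1]` and any `P ⊆ [n]`, `inv` and `imaj` are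
equidistributed on `{π ∈ S_n : Des(π) ⊆ S, PLrmax(π) = P}`. -/
theorem inv_imaj_equidistributed_des_subset_plrmax (n k : ℕ) (s : ℕ → ℕ)
    (hs0 : s 0 = 0) (hsn : s (k + 1) = n) (hmono : ∀ j ≤ k, s j < s (j + 1))
    (P : Finset (Fin n)) :
    ∑ π ∈ Finset.univ.filter (fun π : Equiv.Perm (Fin n) =>
        DesSubset n k s π ∧ PLrmax π = P),
      (X : Polynomial ℤ) ^ inv (fun i => (π i : ℕ)) =
    ∑ π ∈ Finset.univ.filter (fun π : Equiv.Perm (Fin n) =>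
        DesSubset n k s π ∧ PLrmax π = P),
      (X : Polynomial ℤ) ^ maj (fun i => (π.symm i : ℕ)) := by
  classical
  choose Φ hΦ using (exists_foata (n := n))
  have hinj : Function.Injective Φ := by
    intro π π' h
    apply revw_inj
    apply foata_inj
    rw [← hΦ, ← hΦ, h]
  have hdes : ∀ π, DesSubset n k s (Φ π) ↔ DesSubset n k s π := by
    intro π
    unfold DesSubset
    refine forall_congr' fun p => forall_congr' fun hp => ?_
    rw [des_iff _ _ _ hp, des_iff _ _ _ hp,
      max_iff π (Φ π) (hΦ π) _ _ _ ⟨le_rfl, Fin.le_def.2 (by omega)⟩]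
  have hplr : ∀ π, PLrmax (Φ π) = PLrmax π := by
    intro π
    unfold PLrmax
    refine Finset.filter_congr fun i _ => ?_
    have hb : ((⟨0, i.pos⟩ : Fin n) : ℕ) = 0 := rfl
    rw [plr_iff _ _ _ hb, plr_iff _ _ _ hb,
      max_iff π (Φ π) (hΦ π) _ _ _ ⟨Fin.le_def.2 (by simp), le_rfl⟩]
  have hstat : ∀ π : Equiv.Perm (Fin n), inv (fun i => ((Φ π) i : ℕ)) =
      maj (fun i => (π.symm i : ℕ)) := by
    intro π
    have h1 : inv (fun i => ((Φ π) i : ℕ)) = inv (Φ π) := rfl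
    have h2 : maj (fun i => (π.symm i : ℕ)) = maj π.symm := rfl
    rw [h1, h2, ← inv_symm, inv_eq, maj_eq, hΦ, foata_inv _ (revw_nodup _)]
  rw [Finset.sum_filter, Finset.sum_filter]
  rw [← Equiv.sum_comp (Equiv.ofBijective Φ (Finite.injective_iff_bijective.1 hinj))]
  refine Finset.sum_congr rfl fun π _ => ?_
  simp only [Equiv.ofBijective_apply, hdes, hplr, hstat]
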